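/- Linear stability of the IMEX-T scheme (Theorem 3.4): Let 0<β<1, λ, ρ ∈ ℂ, and h>0. Let m be a nonnegative integer and 0<σ_1<⋯<σ_m ≤ 2−β be exponents. Suppose the complex sequence (U_n)_{n≥0} satisfies, for all n ≥ max{2, m+1}, the recurrence U_n = U_0 + ξ[Σ_{j=0}^{n} ω_{n−j}^{(β)} U_j + Σ_{j=1}^{m} W_{n,j}^{(β,σ)} U_j + B_n^σ U_0], where ξ = (λ+ρ)h^β (this is the form that the IMEX-T scheme takes when applied to the linear test equation ^CD_0^β u = λu + ρu with f(t,u) = (λ+ρ)u, since the Taylor linearization of a linear function is exact). Let ω^{(β)}(z) = Σ_{n=0}^∞ ω_n^{(β)} z^n, which converges for |z|<1. If inf_{|z|<1} |1 − ξ ω^{(β)}(z)| > 0, then for every choice of starting values U_0, U_1, …, U_{max{1,m}}, the sequence (U_n)_{n≥0} is bounded. -/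

import Mathlib

/-- Generalized binomial coefficient `C(β,i) = β(β−1)⋯(β−i+1)/i!`. -/
noncomputable def genBinom (β : ℝ) (i : ℕ) : ℝ :=
  (∏ j ∈ Finset.range i, (β - (j : ℝ))) / (Nat.factorial i : ℝ)

/-- Taylor coefficients of the generating function `((1+z)/(2(1−z)))^β`. -/
noncomputable def omegaCoef (β : ℝ) (j : ℕ) : ℝ :=
  (2 : ℝ) ^ (-β) * ∑ i ∈ Finset.range (j + 1),
    genBinom β i * Real.Gamma (β + ((j - i : ℕ) : ℝ)) /
      (Real.Gamma β * (Nat.factorial (j - i) : ℝ))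

/-- The generating function `ω^{(β)}(z) = Σ ω_n^{(β)} z^n` on the unit disk. -/
noncomputable def omegaFnC (β : ℝ) (z : ℂ) : ℂ :=
  ∑' n : ℕ, (omegaCoef β n : ℂ) * z ^ n

/-- `W` solves the Vandermonde system defining the starting weights
`W_{n,j}^{(β,σ)}`, `j = 1,…,m`. -/
def IsStartWeights (β : ℝ) (σ : ℕ → ℝ) (m n : ℕ) (W : ℕ → ℝ) : Prop :=
  ∀ r ∈ Finset.Icc 1 m,
    ∑ j ∈ Finset.Icc 1 m, W j * (j : ℝ) ^ (σ r) =
      Real.Gamma (σ r + 1) / Real.Gamma (σ r + 1 + β) * (n : ℝ) ^ (σ r + β) -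
        ∑ j ∈ Finset.range (n + 1), omegaCoef β (n - j) * (j : ℝ) ^ (σ r)

/-- `B_n^σ` completing the starting weights. -/
noncomputable def Bweight (β : ℝ) (ω W : ℕ → ℝ) (m n : ℕ) : ℝ :=
  (n : ℝ) ^ β / Real.Gamma (1 + β) - ∑ j ∈ Finset.range (n + 1), ω (n - j) -
    ∑ j ∈ Finset.Icc 1 m, W j

open WeakDual in
theorem isUnit_tsum_smul_pow {A : Type*} [NormedRing A] [NormedAlgebra ℂ A] [CompleteSpace A]
    [NormOneClass A] (S : A) (hS : ‖S‖ ≤ 1) (d : ℕ → ℂ) (hd : Summable fun n => ‖d n‖)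
    (hne : ∀ w : ℂ, ‖w‖ ≤ 1 → ∑' n, d n * w ^ n ≠ 0) : IsUnit (∑' n, d n • S ^ n) := by
  let B := Algebra.elemental ℂ S
  let : NormedCommRing B :=
    { (inferInstance : NormedRing B) with mul_comm := mul_comm }
  have : NormOneClass B := ⟨norm_one (α := A)⟩
  let s : B := ⟨S, Algebra.elemental.self_mem ℂ S⟩
  have hs : ‖s‖ ≤ 1 := hS
  have hsum : Summable fun n => d n • s ^ n := by
    refine Summable.of_norm_bounded hd fun n => ?_
    rw [norm_smul]
    exact mul_le_of_le_one_right (norm_nonneg _)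
      ((norm_pow_le s n).trans (pow_le_one₀ (norm_nonneg _) hs))
  have hunit : IsUnit (∑' n, d n • s ^ n) := by
    by_contra hcon
    obtain ⟨φ, hφ⟩ := CharacterSpace.exists_apply_eq_zero hcon
    have h1 : HasSum (fun n => φ (d n • s ^ n)) (φ (∑' n, d n • s ^ n)) :=
      hsum.hasSum.map φ (map_continuous φ)
    refine hne (φ s) ((AlgHom.norm_apply_le_self φ s).trans hs) ?_
    rw [← hφ, ← h1.tsum_eq]
    simp
  have := hunit.map B.val
  have h2 : HasSum (fun n => B.val (d n • s ^ n)) (B.val (∑' n, d n • s ^ n)) :=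
    hsum.hasSum.map B.val continuous_subtype_val
  rw [← h2.tsum_eq] at this
  simpa [s] using this

open BoundedContinuousFunction in
/-- The right shift on bounded sequences. -/
noncomputable def rightShift : (ℕ →ᵇ ℂ) →L[ℂ] (ℕ →ᵇ ℂ) :=
  LinearMap.mkContinuous
    { toFun := fun x => ofNormedAddCommGroupDiscrete (fun n => if n = 0 then 0 else x (n - 1)) ‖x‖ (by
        intro n
        split_ifs
        · simp
        · exact x.norm_coe_le_norm _)
      map_add' := fun x y => by ext n; by_cases h : n = 0 <;> simp [h]
      map_smul' := fun a x => by ext n; by_cases h : n = 0 <;> simp [h] } 1 (by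
    intro x
    rw [one_mul]
    refine (norm_le (norm_nonneg _)).2 fun n => ?_
    by_cases h : n = 0
    · simp [h]
    · simpa [h] using x.norm_coe_le_norm _)

open BoundedContinuousFunction in
theorem norm_rightShift_le : ‖rightShift‖ ≤ 1 := LinearMap.mkContinuous_norm_le _ zero_le_one _

open BoundedContinuousFunction in
theorem rightShift_pow_apply (k : ℕ) (x : ℕ →ᵇ ℂ) (n : ℕ) :
    (rightShift ^ k) x n = if n < k then 0 else x (n - k) := by
  induction k generalizing n with
  | zero => simp
  | succ k ih =>
    rw [pow_succ', mul_apply_eq_comp]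
    change (if n = 0 then 0 else (rightShift ^ k) x (n - 1)) = _
    rw [ih]
    rcases n with _ | n
    · simp
    · simp

open BoundedContinuousFunction PowerSeries in
/-- Wiener-type theorem: an absolutely summable power series without zeros in the closed unit disk
can be divided out while preserving boundedness of coefficients. -/
theorem bounded_of_mul_bounded (d U : ℂ⟦X⟧) (hd : Summable fun n => ‖coeff n d‖)
    (hne : ∀ w : ℂ, ‖w‖ ≤ 1 → ∑' n, coeff n d * w ^ n ≠ 0)
    (C : ℝ) (hC : ∀ n, ‖coeff n (d * U)‖ ≤ C) : ∃ M, ∀ n, ‖coeff n U‖ ≤ M := by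
  have : Nontrivial (ℕ →ᵇ ℂ) :=
    ⟨⟨const ℕ 0, const ℕ 1, fun h => zero_ne_one (congrArg (fun f : ℕ →ᵇ ℂ => f 0) h)⟩⟩
  have hunit := isUnit_tsum_smul_pow rightShift norm_rightShift_le _ hd hne
  set T := ∑' n, coeff n d • rightShift ^ n
  have hTsum : Summable fun n => coeff n d • rightShift ^ n := by
    refine Summable.of_norm_bounded hd fun n => ?_
    rw [norm_smul]
    exact mul_le_of_le_one_right (norm_nonneg _)
      ((norm_pow_le _ n).trans (pow_le_one₀ (norm_nonneg _) norm_rightShift_le))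
  have hTs : HasSum (fun n => coeff n d • rightShift ^ n) T := hTsum.hasSum
  clear_value T
  have hTapp (x : ℕ →ᵇ ℂ) (n : ℕ) : T x n = coeff n (d * PowerSeries.mk x) := by
    have h1 : HasSum (fun k => (coeff k d • rightShift ^ k) x n) (T x n) := by
      have h0 := hTs.mapL (ContinuousLinearMap.apply ℂ (ℕ →ᵇ ℂ) x)
      exact h0.mapL (evalCLM ℂ n)
    rw [coeff_mul, Finset.Nat.sum_antidiagonal_eq_sum_range_succ_mk]
    refine h1.unique ?_
    have h2 (k : ℕ) : (coeff k d • rightShift ^ k) x n =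
        coeff k d * if n < k then 0 else x (n - k) := by
      rw [← rightShift_pow_apply]
      rfl
    have h3 : ∀ k ∉ Finset.range n.succ, (coeff k d • rightShift ^ k) x n = 0 := by
      intro k hk
      have : n < k := by simpa using hk
      rw [h2, if_pos this, mul_zero]
    have h4 := hasSum_sum_of_ne_finset_zero (L := .unconditional ℕ) h3
    rwa [Finset.sum_congr rfl fun k hk => ?_] at h4
    have : ¬ n < k := by simpa [Nat.lt_succ_iff] using hk
    rw [h2, if_neg this, coeff_mk]
  obtain ⟨R, hR⟩ := (isUnit_iff_exists_and_exists.1 hunit).1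
  let y : ℕ →ᵇ ℂ := ofNormedAddCommGroupDiscrete (fun n => coeff n (d * U)) C hC
  have hmul : d * PowerSeries.mk (R y) = d * U := by
    ext n
    rw [← hTapp, ← mul_apply_eq_comp, hR]
    rfl
  have hd0 : d ≠ 0 := by
    rintro rfl
    exact hne 0 (by simp) (by simp)
  have hU : U = PowerSeries.mk (R y) := (mul_left_cancel₀ hd0 hmul).symm
  refine ⟨‖R y‖, fun n => ?_⟩
  rw [hU, coeff_mk]
  exact (R y).norm_coe_le_norm n

theorem exists_finset_deriv_eq_zero (k : ℕ) (t : Finset ℝ) (ht : k + 1 ≤ t.card) (g g' : ℝ → ℝ)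
    (hpos : ∀ x ∈ t, 0 < x) (hg : ∀ x, 0 < x → HasDerivAt g (g' x) x) (hzero : ∀ x ∈ t, g x = 0) :
    ∃ t' : Finset ℝ, k ≤ t'.card ∧ ∀ x ∈ t', 0 < x ∧ g' x = 0 := by
  obtain ⟨t₁, ht₁, hcard⟩ := Finset.exists_subset_card_eq ht
  let e := t₁.orderEmbOfFin hcard
  have he (i) : e i ∈ t := ht₁ (t₁.orderEmbOfFin_mem hcard i)
  have hrolle (i : Fin k) : ∃ y ∈ Set.Ioo (e i.castSucc) (e i.succ), g' y = 0 := by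
    refine exists_hasDerivAt_eq_zero (e.strictMono i.castSucc_lt_succ) ?_ ?_ ?_ (f := g)
    · exact fun x hx => (hg x ((hpos _ (he _)).trans_le hx.1)).continuousAt.continuousWithinAt
    · rw [hzero _ (he _), hzero _ (he _)]
    · exact fun x hx => hg x ((hpos _ (he _)).trans hx.1)
  choose y hy hy0 using hrolle
  have hmono : StrictMono y := by
    intro i j hij
    refine (hy i).2.trans_le (le_trans ?_ (hy j).1.le)
    exact e.monotone (Fin.succ_le_castSucc_iff.2 hij)
  refine ⟨Finset.univ.image y, ?_, ?_⟩
  · rw [Finset.card_image_of_injective _ hmono.injective, Finset.card_fin]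
  · simp only [Finset.mem_image, Finset.mem_univ, true_and, forall_exists_index]
    rintro x i rfl
    exact ⟨(hpos _ (he _)).trans (hy i).1, hy0 i⟩

/-- A nontrivial combination of `k` distinct real powers has fewer than `k` positive zeros. -/
theorem eq_zero_of_sum_rpow_eq_zero (s : Finset ℝ) (c : ℝ → ℝ) (t : Finset ℝ)
    (hcard : s.card ≤ t.card) (ht : ∀ x ∈ t, 0 < x ∧ ∑ a ∈ s, c a * x ^ a = 0) :
    ∀ a ∈ s, c a = 0 := by
  induction s using Finset.induction_on generalizing c t with
  | empty => simp
  | insert a₀ s ha₀ ih =>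
    rw [Finset.card_insert_of_notMem ha₀] at hcard
    obtain ⟨t', ht'card, ht'⟩ := exists_finset_deriv_eq_zero s.card t hcard
      (fun x => ∑ a ∈ insert a₀ s, c a * x ^ (a - a₀))
      (fun x => ∑ a ∈ insert a₀ s, c a * ((a - a₀) * x ^ (a - a₀ - 1)))
      (fun x hx => (ht x hx).1)
      (fun x hx => HasDerivAt.fun_sum fun a _ =>
        (Real.hasDerivAt_rpow_const (Or.inl hx.ne')).const_mul _)
      (fun x hx => by
        have h := (ht x hx).2
        have h2 : ∑ a ∈ insert a₀ s, c a * x ^ (a - a₀) =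
            (∑ a ∈ insert a₀ s, c a * x ^ a) / x ^ a₀ := by
          rw [Finset.sum_div]
          exact Finset.sum_congr rfl fun a _ => by rw [Real.rpow_sub (ht x hx).1, mul_div_assoc]
        simp only [h2, h, zero_div])
    have hs : ∀ a ∈ s, c a = 0 := by
      have := ih (fun a => c a * (a - a₀)) t' ht'card fun x hx => ⟨(ht' x hx).1, by
        have h := (ht' x hx).2
        have hx0 := (ht' x hx).1
        rw [Finset.sum_insert ha₀, sub_self, zero_mul, mul_zero, zero_add] at h
        have h2 : ∑ a ∈ s, c a * (a - a₀) * x ^ a =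
            (∑ a ∈ s, c a * ((a - a₀) * x ^ (a - a₀ - 1))) * x ^ (a₀ + 1) := by
          rw [Finset.sum_mul]
          refine Finset.sum_congr rfl fun a _ => ?_
          rw [mul_assoc, mul_assoc, mul_assoc, ← Real.rpow_add hx0]
          congr 3
          ring
        rw [h2, h, zero_mul]⟩
      intro a ha
      refine (mul_eq_zero.1 (this a ha)).resolve_right (sub_ne_zero.2 ?_)
      rintro rfl
      exact ha₀ ha
    intro a ha
    rcases Finset.mem_insert.1 ha with rfl | ha
    · obtain ⟨x, hx⟩ := Finset.card_pos.1 (Nat.lt_of_lt_of_le (Nat.succ_pos _) hcard)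
      obtain ⟨hx0, h⟩ := ht x hx
      rw [Finset.sum_insert ha₀, Finset.sum_eq_zero fun b hb => by rw [hs b hb, zero_mul],
        add_zero] at h
      exact (mul_eq_zero.1 h).resolve_right (Real.rpow_pos_of_pos hx0 _).ne'
    · exact hs a ha

open Asymptotics in
/-- Solutions of a generalized Vandermonde system with bounded data are bounded. -/
theorem isBigO_one_of_vandermonde (m : ℕ) (σ : ℕ → ℝ) (hσ : StrictMonoOn σ (Set.Icc 1 m))
    (W : ℕ → ℕ → ℝ)
    (hW : ∀ r ∈ Finset.Icc 1 m, (fun n => ∑ j ∈ Finset.Icc 1 m, W n j * (j : ℝ) ^ σ r)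
      =O[Filter.atTop] fun _ => (1 : ℝ)) :
    ∀ j ∈ Finset.Icc 1 m, (fun n => W n j) =O[Filter.atTop] fun _ => (1 : ℝ) := by
  let ι := Finset.Icc 1 m
  let M : Matrix ι ι ℝ := fun r j => ((j : ℕ) : ℝ) ^ σ r
  have hinj : Set.InjOn σ (Finset.Icc 1 m) := by simpa using hσ.injOn
  have hdet : M.det ≠ 0 := by
    intro h0
    obtain ⟨v, hv, hvM⟩ := Matrix.exists_vecMul_eq_zero_iff.2 h0
    refine hv (funext fun r => ?_)
    let c : ℝ → ℝ := fun a => ∑ r : ι, if σ r = a then v r else 0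
    have hc (r : ι) : c (σ r) = v r := by
      simp only [c]
      rw [Finset.sum_eq_single r]
      · simp
      · intro b _ hb
        exact if_neg fun h => hb (Subtype.ext (hinj b.2 r.2 h))
      · simp
    have := eq_zero_of_sum_rpow_eq_zero ((Finset.Icc 1 m).image σ) c
      ((Finset.Icc 1 m).image fun j : ℕ => (j : ℝ))
      (by rw [Finset.card_image_of_injOn hinj, Finset.card_image_of_injective _ Nat.cast_injective])
      (by
        intro x hx
        obtain ⟨j, hj, rfl⟩ := Finset.mem_image.1 hx
        refine ⟨by have := (Finset.mem_Icc.1 hj).1; positivity, ?_⟩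
        rw [Finset.sum_image hinj, ← Finset.sum_coe_sort]
        have h := congrFun hvM ⟨j, hj⟩
        simpa [Matrix.vecMul, dotProduct, M, hc] using h)
    rw [← hc r]
    exact this _ (Finset.mem_image_of_mem _ r.2)
  intro j hj
  have hsolve : (fun n => W n j) = fun n => ∑ r : ι, M⁻¹ ⟨j, hj⟩ r *
      ∑ i ∈ Finset.Icc 1 m, W n i * (i : ℝ) ^ σ r := by
    funext n
    have h : M⁻¹.mulVec (M.mulVec fun i : ι => W n i) = fun i : ι => W n i := by
      rw [Matrix.mulVec_mulVec, Matrix.nonsing_inv_mul _ (isUnit_iff_ne_zero.2 hdet),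
        Matrix.one_mulVec]
    have h2 := (congrFun h ⟨j, hj⟩).symm
    simp only [Matrix.mulVec, dotProduct, M] at h2
    rw [h2]
    refine Finset.sum_congr rfl fun r _ => ?_
    rw [← Finset.sum_coe_sort (Finset.Icc 1 m)]
    congr 1
    exact Finset.sum_congr rfl fun i _ => mul_comm _ _
  rw [hsolve]
  refine IsBigO.fun_sum (s := (Finset.univ : Finset ι)) fun r _ => ?_
  exact (hW r r.2).const_mul_left _

/-- Taylor coefficients of `(1 - z) ^ (-s)`. -/
noncomputable def negBinomCoeff (s : ℝ) (n : ℕ) : ℝ :=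
  (∏ k ∈ Finset.range n, (s + k)) / (n.factorial : ℝ)

@[simp]
theorem negBinomCoeff_zero_right (s : ℝ) : negBinomCoeff s 0 = 1 := by simp [negBinomCoeff]

theorem negBinomCoeff_succ (s : ℝ) (n : ℕ) :
    negBinomCoeff s (n + 1) = negBinomCoeff s n * ((s + n) / (n + 1)) := by
  rw [negBinomCoeff, negBinomCoeff, Finset.prod_range_succ, Nat.factorial_succ]
  push_cast
  field_simp

theorem succ_mul_negBinomCoeff_succ (s : ℝ) (n : ℕ) :
    (n + 1) * negBinomCoeff s (n + 1) = (s + n) * negBinomCoeff s n := by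
  rw [negBinomCoeff_succ]
  field_simp

theorem genBinom_eq_negBinomCoeff (β : ℝ) (n : ℕ) :
    genBinom β n = (-1) ^ n * negBinomCoeff (-β) n := by
  have h : ∏ k ∈ Finset.range n, (-β + k) = (-1) ^ n * ∏ k ∈ Finset.range n, (β - k) := by
    rw [← Finset.card_range n, ← Finset.prod_const, Finset.card_range, ← Finset.prod_mul_distrib]
    exact Finset.prod_congr rfl fun k _ => by ring
  rw [genBinom, negBinomCoeff, h, mul_div_assoc, ← mul_assoc, ← mul_pow]
  simp

theorem Gamma_add_nat_div_eq_negBinomCoeff {s : ℝ} (hs : 0 < s) (n : ℕ) :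
    Real.Gamma (s + n) / (Real.Gamma s * (n.factorial : ℝ)) = negBinomCoeff s n := by
  induction n with
  | zero => simp [(Real.Gamma_pos_of_pos hs).ne']
  | succ n ih =>
    have h : Real.Gamma (s + (n + 1 : ℕ)) = (s + n) * Real.Gamma (s + n) := by
      rw [← Real.Gamma_add_one (by positivity)]
      push_cast
      ring_nf
    have := Real.Gamma_pos_of_pos hs
    rw [negBinomCoeff_succ, ← ih, h, Nat.factorial_succ]
    push_cast
    field_simp

theorem negBinomCoeff_pos {s : ℝ} (hs : 0 < s) (n : ℕ) : 0 < negBinomCoeff s n :=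
  div_pos (Finset.prod_pos fun k _ => by positivity) (by positivity)

theorem negBinomCoeff_one (n : ℕ) : negBinomCoeff 1 n = 1 := by
  induction n with
  | zero => simp
  | succ n ih =>
    rw [negBinomCoeff_succ, ih]
    field_simp
    ring

theorem abs_negBinomCoeff_le_one {s : ℝ} (h₁ : -1 ≤ s) (h₂ : s ≤ 1) (n : ℕ) :
    |negBinomCoeff s n| ≤ 1 := by
  induction n with
  | zero => simp
  | succ n ih =>
    rw [negBinomCoeff_succ, abs_mul]
    refine mul_le_one₀ ih (abs_nonneg _) ?_
    rw [abs_div, abs_of_pos (by positivity : (0 : ℝ) < n + 1), div_le_one (by positivity), abs_le]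
    constructor <;> linarith [(Nat.cast_nonneg n : (0 : ℝ) ≤ n)]

theorem negBinomCoeff_eq_multichoose (s : ℝ) (n : ℕ) :
    negBinomCoeff s n = Ring.multichoose s n := by
  have h := Ring.factorial_nsmul_multichoose_eq_ascPochhammer s n
  rw [Polynomial.ascPochhammer_smeval_eq_eval] at h
  have h2 : (ascPochhammer ℝ n).eval s = ∏ k ∈ Finset.range n, (s + k) := by
    induction n with
    | zero => simp
    | succ n ih =>
      rw [ascPochhammer_succ_eval, Finset.prod_range_succ, ih]
      exact Ring.factorial_nsmul_multichoose_eq_ascPochhammer s n |>.trans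
        (Polynomial.ascPochhammer_smeval_eq_eval s n)
  rw [h2, nsmul_eq_mul] at h
  rw [negBinomCoeff, ← h]
  field_simp

theorem hasSum_negBinomCoeff_mul_pow (s : ℝ) {x : ℝ} (hx : |x| < 1) :
    HasSum (fun n => negBinomCoeff s n * x ^ n) (1 / (1 - x) ^ s) := by
  have h := (Real.one_div_one_sub_rpow_hasFPowerSeriesOnBall_zero s).hasSum (y := x)
    (by simpa [enorm_eq_nnnorm, ← NNReal.coe_lt_coe] using hx)
  simp only [zero_add, FormalMultilinearSeries.ofScalars_apply_eq, smul_eq_mul] at h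
  refine h.congr_fun fun n => ?_
  rw [negBinomCoeff_eq_multichoose, Ring.choose]
  congr 2
  ring

open PowerSeries

/-- The formal power series of `(1 - z) ^ (-s)`. -/
noncomputable def negBinomSeries (s : ℝ) : ℝ⟦X⟧ := PowerSeries.mk (negBinomCoeff s)

@[simp]
theorem coeff_negBinomSeries (s : ℝ) (n : ℕ) :
    coeff n (negBinomSeries s) = negBinomCoeff s n := coeff_mk _ _

theorem negBinomSeries_add (s t : ℝ) :
    negBinomSeries (s + t) = negBinomSeries s * negBinomSeries t := by
  have key (n : ℕ) : ((n : ℝ) + 1) * coeff (n + 1) (negBinomSeries s * negBinomSeries t) =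
      (s + t + n) * coeff n (negBinomSeries s * negBinomSeries t) := by
    rw [mul_comm ((n : ℝ) + 1), ← coeff_derivative, Derivation.leibniz]
    simp only [map_add, smul_eq_mul]
    rw [mul_comm (negBinomSeries t) (d⁄dX ℝ _)]
    simp only [coeff_mul, coeff_derivative, coeff_negBinomSeries]
    rw [← Finset.sum_add_distrib, Finset.mul_sum]
    refine Finset.sum_congr rfl fun p hp => ?_
    have hn : (n : ℝ) = p.1 + p.2 := by
      rw [← Finset.HasAntidiagonal.mem_antidiagonal.1 hp]
      push_cast
      rfl
    linear_combination negBinomCoeff s p.1 * succ_mul_negBinomCoeff_succ t p.2 +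
      negBinomCoeff t p.2 * succ_mul_negBinomCoeff_succ s p.1 -
      negBinomCoeff s p.1 * negBinomCoeff t p.2 * hn
  ext n
  induction n with
  | zero => simp [coeff_mul]
  | succ n ih =>
    have h := succ_mul_negBinomCoeff_succ (s + t) n
    rw [← coeff_negBinomSeries, ← coeff_negBinomSeries, ih, ← key] at h
    exact mul_left_cancel₀ (by positivity) h

@[simp]
theorem negBinomSeries_zero : negBinomSeries 0 = 1 := by
  have h := negBinomSeries_add 0 0
  rw [add_zero] at h
  refine (mul_eq_left₀ fun h0 => ?_).1 h.symm
  simpa using congrArg (coeff 0) h0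

theorem negBinomSeries_neg_one : negBinomSeries (-1) = 1 - X := by
  ext n
  rcases n with _ | _ | n
  · simp
  · simp [negBinomCoeff_succ, coeff_one, coeff_X]
  · rw [coeff_negBinomSeries, negBinomCoeff, Finset.prod_eq_zero (i := 1) (by simp) (by simp)]
    simp [coeff_one, coeff_X]

theorem negBinomCoeff_neg_of_neg {β : ℝ} (h0 : 0 < β) (h1 : β < 1) (n : ℕ) :
    negBinomCoeff (-β) (n + 1) < 0 := by
  induction n with
  | zero => simp [negBinomCoeff_succ, h0]
  | succ n ih =>
    rw [negBinomCoeff_succ]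
    refine mul_neg_of_neg_of_pos ih (div_pos ?_ (by positivity))
    push_cast
    linarith [(Nat.cast_nonneg n : (0 : ℝ) ≤ n)]

theorem sum_range_negBinomCoeff (s : ℝ) (n : ℕ) :
    ∑ k ∈ Finset.range (n + 1), negBinomCoeff s k = negBinomCoeff (s + 1) n := by
  rw [← coeff_negBinomSeries (s + 1), negBinomSeries_add, coeff_mul,
    Finset.Nat.sum_antidiagonal_eq_sum_range_succ_mk]
  simp [negBinomCoeff_one]

theorem sum_range_abs_negBinomCoeff_le {β : ℝ} (h0 : 0 < β) (h1 : β < 1) (n : ℕ) :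
    ∑ k ∈ Finset.range n, |negBinomCoeff (-β) (k + 1)| ≤ 1 := by
  have h := sum_range_negBinomCoeff (-β) n
  rw [Finset.sum_range_succ', negBinomCoeff_zero_right] at h
  rw [Finset.sum_congr rfl fun k _ => abs_of_neg (negBinomCoeff_neg_of_neg h0 h1 k),
    Finset.sum_neg_distrib]
  linarith [negBinomCoeff_pos (by linarith : 0 < -β + 1) n]

theorem summable_abs_negBinomCoeff_succ {β : ℝ} (h0 : 0 < β) (h1 : β < 1) :
    Summable fun n => |negBinomCoeff (-β) (n + 1)| :=
  summable_of_sum_range_le (fun _ => abs_nonneg _) (sum_range_abs_negBinomCoeff_le h0 h1)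

theorem tsum_abs_negBinomCoeff_succ_le {β : ℝ} (h0 : 0 < β) (h1 : β < 1) :
    ∑' n, |negBinomCoeff (-β) (n + 1)| ≤ 1 :=
  Real.tsum_le_of_sum_range_le (fun _ => abs_nonneg _) (sum_range_abs_negBinomCoeff_le h0 h1)

theorem summable_abs_negBinomCoeff {β : ℝ} (h0 : 0 < β) (h1 : β < 1) :
    Summable fun n => |negBinomCoeff (-β) n| :=
  (summable_nat_add_iff 1).1 (summable_abs_negBinomCoeff_succ h0 h1)

theorem negBinomCoeff_mul_choose (s : ℝ) (n j : ℕ) :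
    negBinomCoeff s (j + n) * ((j + n).choose n : ℝ) =
      negBinomCoeff s n * negBinomCoeff (s + n) j := by
  have h := Nat.add_choose_mul_factorial_mul_factorial j n
  have h' : ((j + n).choose n : ℝ) * j.factorial * n.factorial = (j + n).factorial := by
    exact_mod_cast h
  have hp : ∏ k ∈ Finset.range (j + n), (s + k) =
      (∏ k ∈ Finset.range n, (s + k)) * ∏ k ∈ Finset.range j, (s + n + k) := by
    rw [add_comm j n, Finset.prod_range_add]
    congr 1
    exact Finset.prod_congr rfl fun k _ => by push_cast; ring
  rw [negBinomCoeff, negBinomCoeff, negBinomCoeff, hp, ← h']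
  have : ((j + n).choose n : ℝ) ≠ 0 := by
    exact_mod_cast (Nat.choose_pos (Nat.le_add_left n j)).ne'
  field_simp

theorem coeff_one_sub_X_pow (k n : ℕ) :
    coeff n ((1 - X : ℝ⟦X⟧) ^ k) = (-1) ^ n * (k.choose n : ℝ) := by
  have h : (1 - X : ℝ⟦X⟧) ^ k =
      rescale (-1 : ℝ) (((1 + Polynomial.X : Polynomial ℝ) ^ k : Polynomial ℝ) : ℝ⟦X⟧) := by
    simp [rescale_X, sub_eq_add_neg]
  rw [h, coeff_rescale, Polynomial.coeff_coe, Polynomial.coeff_one_add_X_pow]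

/-- The power series of `((1 + z) / 2) ^ β`. -/
noncomputable def halfBinomSeries (β : ℝ) : ℝ⟦X⟧ :=
  PowerSeries.mk fun n => (2 : ℝ) ^ (-β) * genBinom β n

/-- Expansion of `((1 + z) / 2) ^ β` in powers of `(1 - z) / 2`. -/
theorem hasSum_coeff_halfBinomSeries (β : ℝ) (n : ℕ) :
    HasSum (fun k => negBinomCoeff (-β) k * (1 / 2) ^ k * coeff n ((1 - X : ℝ⟦X⟧) ^ k))
      (coeff n (halfBinomSeries β)) := by
  rw [← hasSum_nat_add_iff' n, Finset.sum_eq_zero fun k hk => ?_, sub_zero]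
  · have h := (hasSum_negBinomCoeff_mul_pow (-β + n) (x := 1 / 2) (by norm_num [abs_of_pos]))
      |>.mul_left ((-1) ^ n * negBinomCoeff (-β) n * (1 / 2) ^ n)
    have hval : coeff n (halfBinomSeries β) = (-1) ^ n * negBinomCoeff (-β) n * (1 / 2) ^ n *
        (1 / (1 - 1 / 2) ^ (-β + n)) := by
      rw [halfBinomSeries, coeff_mk, genBinom_eq_negBinomCoeff,
        show (1 : ℝ) - 1 / 2 = 2⁻¹ by norm_num, Real.inv_rpow (by norm_num), one_div, one_div,
        inv_inv, Real.rpow_add (by norm_num), Real.rpow_natCast, inv_pow]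
      field_simp
    rw [hval]
    refine h.congr_fun fun j => ?_
    rw [coeff_one_sub_X_pow, pow_add]
    linear_combination (1 / 2) ^ j * (1 / 2) ^ n * (-1) ^ n * negBinomCoeff_mul_choose (-β) n j
  · rw [coeff_one_sub_X_pow, Nat.choose_eq_zero_of_lt (Finset.mem_range.1 hk)]
    simp

/-- The power series of `(((1 + z) / 2) ^ β - 1 + β (1 - z) / 2) / (1 - z) ^ 2`. -/
noncomputable def remainderSeries (β : ℝ) : ℝ⟦X⟧ :=
  PowerSeries.mk fun n =>
    ∑' k, negBinomCoeff (-β) (k + 2) * (1 / 2) ^ (k + 2) * coeff n ((1 - X : ℝ⟦X⟧) ^ k)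

theorem summable_remainder_terms {β : ℝ} (h0 : 0 < β) (h1 : β < 1) :
    Summable fun p : ℕ × ℕ =>
      ‖negBinomCoeff (-β) (p.1 + 2) * (1 / 2) ^ (p.1 + 2) * coeff p.2 ((1 - X : ℝ⟦X⟧) ^ p.1)‖ := by
  have hchoose (k : ℕ) : HasSum (fun n => ‖coeff n ((1 - X : ℝ⟦X⟧) ^ k)‖) (2 ^ k) := by
    have h : ∀ n ∉ Finset.range (k + 1), ‖coeff n ((1 - X : ℝ⟦X⟧) ^ k)‖ = 0 := by
      intro n hn
      rw [coeff_one_sub_X_pow, Nat.choose_eq_zero_of_lt (by simpa using hn)]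
      simp
    convert hasSum_sum_of_ne_finset_zero h using 1
    · have := Nat.sum_range_choose k
      rw [← Nat.cast_ofNat, ← Nat.cast_pow, ← this]
      push_cast
      exact Finset.sum_congr rfl fun n _ => by simp [coeff_one_sub_X_pow]
    · infer_instance
  have hrow (k : ℕ) := (hchoose k).mul_left ‖negBinomCoeff (-β) (k + 2) * (1 / 2) ^ (k + 2)‖
  rw [summable_prod_of_nonneg fun _ => norm_nonneg _]
  simp only [norm_mul _ (coeff _ _)]
  refine ⟨fun k => (hrow k).summable, ?_⟩
  simp only [(hrow _).tsum_eq]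
  refine (((summable_nat_add_iff 2).2 (summable_abs_negBinomCoeff h0 h1)).mul_right (1 / 4)).congr
    fun k => ?_
  rw [norm_mul, Real.norm_eq_abs, Real.norm_of_nonneg (by positivity), mul_assoc]
  congr 1
  rw [pow_add, mul_right_comm, ← mul_pow]
  norm_num

theorem summable_coeff_remainderSeries {β : ℝ} (h0 : 0 < β) (h1 : β < 1) :
    Summable fun n => ‖coeff n (remainderSeries β)‖ := by
  have h := (summable_remainder_terms h0 h1).prod_symm
  refine Summable.of_nonneg_of_le (fun _ => norm_nonneg _) (fun n => ?_) h.prod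
  rw [remainderSeries, coeff_mk]
  exact norm_tsum_le_tsum_norm (h.prod_factor n)

theorem halfBinomSeries_eq {β : ℝ} (h0 : 0 < β) (h1 : β < 1) :
    halfBinomSeries β = 1 - C (β / 2) * (1 - X) + (1 - X) ^ 2 * remainderSeries β := by
  ext n
  have hsum (j : ℕ) : HasSum
      (fun k => negBinomCoeff (-β) (k + 2) * (1 / 2) ^ (k + 2) * coeff j ((1 - X : ℝ⟦X⟧) ^ k))
      (coeff j (remainderSeries β)) := by
    rw [remainderSeries, coeff_mk]
    exact ((summable_remainder_terms h0 h1).prod_symm.prod_factor j).of_norm.hasSum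
  have h2 := hasSum_sum (s := Finset.HasAntidiagonal.antidiagonal n) fun p _ =>
    (hsum p.2).mul_left (coeff p.1 ((1 - X : ℝ⟦X⟧) ^ 2))
  rw [← coeff_mul] at h2
  have h3 := (hasSum_nat_add_iff' 2).2 (hasSum_coeff_halfBinomSeries β n)
  have h4 := h3.unique (h2.congr_fun fun k => ?_)
  · rw [Finset.sum_range_succ, Finset.sum_range_one, sub_eq_iff_eq_add] at h4
    rw [h4, map_add, map_sub, coeff_C_mul, negBinomCoeff_succ]
    simp
    ring
  · rw [pow_add (1 - X : ℝ⟦X⟧) k 2, mul_comm _ ((1 - X : ℝ⟦X⟧) ^ 2), coeff_mul, Finset.mul_sum]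
    exact Finset.sum_congr rfl fun p _ => by ring

open Filter Asymptotics Topology

theorem add_natCast_mul_negBinomCoeff (s : ℝ) (n : ℕ) :
    (s + n) * negBinomCoeff s n = s * negBinomCoeff (s + 1) n := by
  have h : (∏ k ∈ Finset.range n, (s + k)) * (s + n) =
      (∏ k ∈ Finset.range n, (s + 1 + k)) * s := by
    rw [← Finset.prod_range_succ (fun k : ℕ => s + k), Finset.prod_range_succ']
    simp only [Nat.cast_zero, add_zero]
    congr 1
    exact Finset.prod_congr rfl fun k _ => by push_cast; ring
  rw [negBinomCoeff, negBinomCoeff]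
  field_simp
  linear_combination h

theorem tendsto_Gamma_mul_negBinomCoeff {σ : ℝ} (hσ : 0 < σ) :
    Tendsto (fun n : ℕ => Real.Gamma (σ + 1) * negBinomCoeff (σ + 1) n / (n : ℝ) ^ σ) atTop
      (𝓝 1) := by
  have hG := (Real.Gamma_pos_of_pos hσ).ne'
  have h := (tendsto_const_nhds (x := Real.Gamma σ)).div (Real.GammaSeq_tendsto_Gamma σ) hG
  rw [div_self hG] at h
  refine h.congr fun n => ?_
  have h1 := add_natCast_mul_negBinomCoeff σ n
  have h2 : ∏ j ∈ Finset.range (n + 1), (σ + j) = n.factorial * (σ * negBinomCoeff (σ + 1) n) := by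
    rw [Finset.prod_range_succ, ← h1, negBinomCoeff]
    field_simp
  change Real.Gamma σ / Real.GammaSeq σ n = _
  rw [Real.GammaSeq, h2, Real.Gamma_add_one hσ.ne']
  have := negBinomCoeff_pos (by linarith : 0 < σ + 1) n
  rcases eq_or_ne ((n : ℝ) ^ σ) 0 with h0 | h0
  · simp [h0]
  · field_simp

theorem isBigO_log_one_add_div (s : ℝ) :
    (fun n : ℕ => Real.log (1 + s / n) - (s / n - (s / n) ^ 2 / 2)) =O[atTop]
      fun n : ℕ => ((n : ℝ)⁻¹) ^ 3 := by
  refine IsBigO.of_bound (2 * |s| ^ 3) ?_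
  have h := tendsto_natCast_atTop_atTop (R := ℝ) |>.eventually_ge_atTop (2 * |s| + 1)
  filter_upwards [h] with n hn
  have hn0 : (0 : ℝ) < n := by linarith [abs_nonneg s]
  have hx : |-(s / n)| ≤ 1 / 2 := by
    rw [abs_neg, abs_div, abs_of_pos hn0, div_le_iff₀ hn0]
    linarith
  have h2 := Real.abs_log_sub_add_sum_range_le (x := -(s / n)) (by linarith) 2
  rw [Real.norm_eq_abs, Real.norm_of_nonneg (by positivity)]
  calc _ = |(∑ i ∈ Finset.range 2, (-(s / n)) ^ (i + 1) / ((i : ℝ) + 1)) +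
          Real.log (1 - -(s / n))| := by
        congr 1
        simp [Finset.sum_range_succ]
        ring
    _ ≤ _ := h2
    _ ≤ |-(s / n)| ^ 3 / (1 / 2) := by gcongr; linarith
    _ = _ := by
        rw [abs_neg, abs_div, abs_of_pos hn0]
        field_simp

theorem eventually_abs_le_of_abs_sub_le {u v : ℕ → ℝ} (hu : Tendsto u atTop (𝓝 0))
    (hv : Tendsto v atTop (𝓝 0)) (h : ∀ᶠ n in atTop, |u (n + 1) - u n| ≤ v n - v (n + 1)) :
    ∀ᶠ n in atTop, |u n| ≤ v n := by
  obtain ⟨N, hN⟩ := eventually_atTop.1 h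
  filter_upwards [eventually_ge_atTop N] with n hn
  have hk (k : ℕ) : |u (n + k) - u n| ≤ v n - v (n + k) := by
    induction k with
    | zero => simp
    | succ k ih =>
      calc |u (n + (k + 1)) - u n| ≤ |u (n + k + 1) - u (n + k)| + |u (n + k) - u n| := by
            refine le_trans (le_of_eq ?_) (abs_add_le _ _)
            congr 1
            rw [add_assoc]
            ring
        _ ≤ (v (n + k) - v (n + k + 1)) + (v n - v (n + k)) :=
            add_le_add (hN _ (hn.trans (Nat.le_add_right _ _))) ih
        _ = _ := by rw [add_assoc]; ring
  have hu' := ((hu.comp (tendsto_add_atTop_nat n)).sub_const (u n)).abs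
  have hv' := (hv.comp (tendsto_add_atTop_nat n)).const_sub (v n)
  have := le_of_tendsto_of_tendsto hu' hv' (Eventually.of_forall fun k => by
    simpa [add_comm n] using hk k)
  simpa using this

theorem isBigO_log_Gamma_mul_negBinomCoeff {σ : ℝ} (hσ : 0 < σ) :
    (fun n : ℕ => Real.log (Real.Gamma (σ + 1) * negBinomCoeff (σ + 1) n / (n : ℝ) ^ σ) -
      σ * (σ + 1) / 2 / n) =O[atTop] fun n : ℕ => ((n : ℝ)⁻¹) ^ 2 := by
  set b : ℕ → ℝ := fun n => Real.Gamma (σ + 1) * negBinomCoeff (σ + 1) n / (n : ℝ) ^ σ with hb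
  set u : ℕ → ℝ := fun n => Real.log (b n) - σ * (σ + 1) / 2 / n with hu
  have hulim : Tendsto u atTop (𝓝 0) := by
    have h1 := (tendsto_Gamma_mul_negBinomCoeff hσ).log one_ne_zero
    have h2 := tendsto_const_div_atTop_nhds_zero_nat (σ * (σ + 1) / 2)
    simpa using h1.sub h2
  have hstep : ∀ᶠ n : ℕ in atTop, u (n + 1) - u n =
      (Real.log (1 + (σ + 1) / n) - ((σ + 1) / n - ((σ + 1) / n) ^ 2 / 2)) -
      (σ + 1) * (Real.log (1 + 1 / n) - (1 / n - (1 / n) ^ 2 / 2)) -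
      σ * (σ + 1) / 2 * (((n : ℝ)⁻¹) ^ 2 * ((n : ℝ) + 1)⁻¹) := by
    filter_upwards [eventually_gt_atTop 0] with n hn
    have hn0 : (0 : ℝ) < n := by exact_mod_cast hn
    have hpos := negBinomCoeff_pos (by linarith : 0 < σ + 1) n
    have hG := Real.Gamma_pos_of_pos (by linarith : 0 < σ + 1)
    have hbn : 0 < b n := by positivity
    have hratio : b (n + 1) = b n * (1 + (σ + 1) / n) / (1 + 1 / n) ^ (σ + 1) := by
      have h1 : (1 + 1 / (n : ℝ)) ^ (σ + 1) =
          ((n : ℝ) + 1) ^ σ / (n : ℝ) ^ σ * (((n : ℝ) + 1) / n) := by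
        rw [Real.rpow_add_one (by positivity), ← Real.div_rpow (by positivity) hn0.le]
        congr 2 <;> field_simp
      have hp1 : 0 < (n : ℝ) ^ σ := Real.rpow_pos_of_pos hn0 _
      have hp2 : 0 < ((n : ℝ) + 1) ^ σ := Real.rpow_pos_of_pos (by linarith) _
      simp only [hb]
      rw [h1, negBinomCoeff_succ]
      push_cast
      field_simp
      ring
    have hlog : Real.log (b (n + 1)) = Real.log (b n) + Real.log (1 + (σ + 1) / n) -
        (σ + 1) * Real.log (1 + 1 / n) := by
      rw [hratio, Real.log_div (by positivity) (by positivity), Real.log_mul (by positivity)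
        (by positivity), Real.log_rpow (by positivity)]
    simp only [hu]
    rw [hlog]
    push_cast
    field_simp
    ring
  have hO : (fun n => u (n + 1) - u n) =O[atTop] fun n : ℕ => ((n : ℝ)⁻¹) ^ 3 := by
    refine IsBigO.congr' (((isBigO_log_one_add_div (σ + 1)).sub
      ((isBigO_log_one_add_div 1).const_mul_left (σ + 1))).sub (IsBigO.const_mul_left ?_ _))
      (hstep.mono fun _ h => h.symm) EventuallyEq.rfl
    refine IsBigO.of_bound 1 ?_
    filter_upwards [eventually_gt_atTop 0] with n hn
    have hn0 : (0 : ℝ) < n := by exact_mod_cast hn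
    rw [Real.norm_of_nonneg (by positivity), Real.norm_of_nonneg (by positivity), one_mul,
      pow_succ ((n : ℝ)⁻¹) 2]
    exact mul_le_mul_of_nonneg_left (inv_anti₀ hn0 (by linarith)) (by positivity)
  obtain ⟨C, hC0, hC⟩ := hO.exists_pos
  have hv : Tendsto (fun n : ℕ => 4 * C * ((n : ℝ)⁻¹) ^ 2) atTop (𝓝 0) := by
    simpa using ((tendsto_inv_atTop_nhds_zero_nat (𝕜 := ℝ)).pow 2).const_mul (4 * C)
  refine IsBigO.of_bound (4 * C) ?_
  have := eventually_abs_le_of_abs_sub_le hulim hv (by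
    filter_upwards [hC.bound, eventually_gt_atTop 0] with n h1 hn
    have hn0 : (1 : ℝ) ≤ n := by exact_mod_cast hn
    rw [Real.norm_eq_abs, Real.norm_of_nonneg (by positivity)] at h1
    refine h1.trans ?_
    push_cast
    rw [← mul_sub, mul_comm 4 C, mul_assoc]
    refine mul_le_mul_of_nonneg_left ?_ hC0.le
    have h2 : 4 * (((n : ℝ)⁻¹) ^ 2 - (((n : ℝ) + 1)⁻¹) ^ 2) - ((n : ℝ)⁻¹) ^ 3 =
        (4 * n * (2 * n + 1) - (n + 1) ^ 2) / (n ^ 3 * (n + 1) ^ 2) := by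
      field_simp
      ring
    rw [← sub_nonneg, h2]
    exact div_nonneg (by nlinarith) (by positivity))
  filter_upwards [this] with n hn
  rwa [Real.norm_eq_abs, Real.norm_of_nonneg (by positivity)]

/-- Two-term expansion of `n ^ σ` in coefficients of negative binomial series. -/
theorem isBigO_rpow_sub_negBinomCoeff {σ : ℝ} (hσ : 0 ≤ σ) :
    (fun n : ℕ => (n : ℝ) ^ σ - Real.Gamma (σ + 1) *
      (negBinomCoeff (σ + 1) n - (σ + 1) / 2 * negBinomCoeff σ n)) =O[atTop]
      fun n : ℕ => (n : ℝ) ^ (σ - 2) := by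
  rcases hσ.eq_or_lt with rfl | hσ
  · refine IsBigO.congr' (isBigO_zero _ _) ?_ EventuallyEq.rfl
    filter_upwards [eventually_gt_atTop 0] with n hn
    obtain ⟨n, rfl⟩ := Nat.exists_eq_succ_of_ne_zero hn.ne'
    have h0 : negBinomCoeff 0 (n + 1) = 0 := by
      rw [negBinomCoeff, Finset.prod_eq_zero (i := 0) (by simp) (by simp), zero_div]
    simp [negBinomCoeff_one, h0]
  set b : ℕ → ℝ := fun n => Real.Gamma (σ + 1) * negBinomCoeff (σ + 1) n / (n : ℝ) ^ σ with hb
  set κ : ℝ := σ * (σ + 1) / 2 with hκ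
  have hκ0 : 0 < κ := by positivity
  have hinv : (fun n : ℕ => κ / n) =O[atTop] fun n : ℕ => (n : ℝ)⁻¹ :=
    (isBigO_refl (fun n : ℕ => (n : ℝ)⁻¹) atTop).const_mul_left κ
  have hsq : (fun n : ℕ => ((n : ℝ)⁻¹) ^ 2) =O[atTop] fun n : ℕ => (n : ℝ)⁻¹ := by
    refine IsBigO.of_bound 1 ?_
    filter_upwards [eventually_gt_atTop 0] with n hn
    have hn1 : (1 : ℝ) ≤ n := by exact_mod_cast hn
    rw [norm_pow, one_mul, pow_two]
    refine mul_le_of_le_one_left (norm_nonneg _) ?_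
    rw [norm_inv, Real.norm_of_nonneg (by positivity)]
    exact inv_le_one_of_one_le₀ hn1
  have hlog := isBigO_log_Gamma_mul_negBinomCoeff hσ
  have hlog1 : (fun n => Real.log (b n)) =O[atTop] fun n : ℕ => (n : ℝ)⁻¹ := by
    refine ((hlog.trans hsq).add hinv).congr_left fun n => ?_
    simp only [hb, hκ]
    ring
  have hlog0 : Tendsto (fun n => Real.log (b n)) atTop (𝓝 0) :=
    hlog1.trans_tendsto tendsto_inv_atTop_nhds_zero_nat
  have hexp : (fun n => b n - 1 - Real.log (b n)) =O[atTop] fun n : ℕ => ((n : ℝ)⁻¹) ^ 2 := by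
    refine IsBigO.trans (IsBigO.of_bound 1 ?_) (hlog1.pow 2)
    filter_upwards [hlog0.abs.eventually_le_const (by norm_num : |(0 : ℝ)| < 1),
      eventually_gt_atTop 0] with n hn hn0
    have hpos := negBinomCoeff_pos (by linarith : 0 < σ + 1) n
    have hG := Real.Gamma_pos_of_pos (by linarith : 0 < σ + 1)
    have hn0' : (0 : ℝ) < n := by exact_mod_cast hn0
    have hbn : 0 < b n := by positivity
    have := Real.abs_exp_sub_one_sub_id_le hn
    rw [Real.exp_log hbn] at this
    rw [one_mul, Real.norm_eq_abs, Real.norm_of_nonneg (sq_nonneg _)]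
    exact this
  have hb1 : (fun n => b n - 1 - κ / n) =O[atTop] fun n : ℕ => ((n : ℝ)⁻¹) ^ 2 :=
    (hexp.add hlog).congr_left fun n => by ring
  have hb1' : (fun n => b n - 1) =O[atTop] fun n : ℕ => (n : ℝ)⁻¹ := by
    simpa using (hb1.trans hsq).add hinv
  have hc : (fun n : ℕ => κ / (σ + n)) =O[atTop] fun n : ℕ => (n : ℝ)⁻¹ := by
    refine IsBigO.of_bound κ ?_
    filter_upwards [eventually_gt_atTop 0] with n hn
    have hn0 : (0 : ℝ) < n := by exact_mod_cast hn
    rw [Real.norm_of_nonneg (by positivity), Real.norm_of_nonneg (by positivity), div_eq_mul_inv]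
    gcongr
    linarith
  have hd : (fun n : ℕ => κ / n - κ / (σ + n)) =O[atTop] fun n : ℕ => ((n : ℝ)⁻¹) ^ 2 := by
    refine IsBigO.congr' (((isBigO_refl (fun n : ℕ => (n : ℝ)⁻¹) atTop).mul hc).const_mul_left σ)
      ?_ (Eventually.of_forall fun n => (pow_two _).symm)
    filter_upwards [eventually_gt_atTop 0] with n hn
    have hn0 : (0 : ℝ) < n := by exact_mod_cast hn
    field_simp
    ring
  have hmain : (fun n : ℕ => 1 - b n * (1 - κ / (σ + n))) =O[atTop]
      fun n : ℕ => ((n : ℝ)⁻¹) ^ 2 := by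
    have h1 := ((hb1'.mul hc).congr_right fun n => (pow_two _).symm)
    exact ((h1.sub hb1).sub hd).congr_left fun n => by ring
  refine IsBigO.congr' ((isBigO_refl (fun n : ℕ => (n : ℝ) ^ σ) atTop).mul hmain) ?_ ?_
  · filter_upwards [eventually_gt_atTop 0] with n hn
    have hn0 : (0 : ℝ) < n := by exact_mod_cast hn
    have hp : 0 < (n : ℝ) ^ σ := Real.rpow_pos_of_pos hn0 _
    have h1 := add_natCast_mul_negBinomCoeff σ n
    have h2 : negBinomCoeff σ n = σ * negBinomCoeff (σ + 1) n / (σ + n) := by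
      field_simp
      linear_combination h1
    simp only [hb, hκ]
    rw [h2]
    field_simp
  · filter_upwards [eventually_gt_atTop 0] with n hn
    have hn0 : (0 : ℝ) < n := by exact_mod_cast hn
    rw [Real.rpow_sub hn0, div_eq_mul_inv, inv_pow]
    norm_num

theorem mk_omegaCoef {β : ℝ} (hβ : 0 < β) :
    PowerSeries.mk (omegaCoef β) = halfBinomSeries β * negBinomSeries β := by
  ext n
  rw [coeff_mk, coeff_mul, Finset.Nat.sum_antidiagonal_eq_sum_range_succ_mk, omegaCoef,
    Finset.mul_sum]
  refine Finset.sum_congr rfl fun i _ => ?_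
  rw [halfBinomSeries, coeff_mk, coeff_negBinomSeries, mul_div_assoc,
    Gamma_add_nat_div_eq_negBinomCoeff hβ, mul_assoc]

/-- The power series `f` has bounded coefficients. -/
def HasBoundedCoeffs {𝕜 : Type*} [NormedField 𝕜] (f : 𝕜⟦X⟧) : Prop :=
  ∃ K, ∀ n, ‖coeff n f‖ ≤ K

namespace HasBoundedCoeffs

variable {𝕜 : Type*} [NormedField 𝕜] {f g : 𝕜⟦X⟧}

theorem of_isBigO_one (h : (fun n => coeff n f) =O[atTop] fun _ => (1 : ℝ)) :
    HasBoundedCoeffs f :=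
  let ⟨K, hK⟩ := isBigO_one_nat_atTop_iff.1 h
  ⟨K, hK⟩

theorem isBigO_one (h : HasBoundedCoeffs f) :
    (fun n => coeff n f) =O[atTop] fun _ => (1 : ℝ) :=
  isBigO_one_nat_atTop_iff.2 h

theorem add (hf : HasBoundedCoeffs f) (hg : HasBoundedCoeffs g) : HasBoundedCoeffs (f + g) :=
  of_isBigO_one <| by simpa using hf.isBigO_one.add hg.isBigO_one

theorem sub (hf : HasBoundedCoeffs f) (hg : HasBoundedCoeffs g) : HasBoundedCoeffs (f - g) :=
  of_isBigO_one <| by simpa using hf.isBigO_one.sub hg.isBigO_one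

theorem mul_left (hg : Summable fun n => ‖coeff n g‖) (hf : HasBoundedCoeffs f) :
    HasBoundedCoeffs (g * f) := by
  obtain ⟨K, hK⟩ := hf
  have hK0 : 0 ≤ K := (norm_nonneg _).trans (hK 0)
  refine ⟨(∑' n, ‖coeff n g‖) * K, fun n => ?_⟩
  rw [coeff_mul, Finset.Nat.sum_antidiagonal_eq_sum_range_succ_mk]
  calc ‖∑ k ∈ Finset.range n.succ, coeff k g * coeff (n - k) f‖
      ≤ ∑ k ∈ Finset.range n.succ, ‖coeff k g‖ * K := by
        refine norm_sum_le_of_le _ fun k _ => ?_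
        rw [norm_mul]
        gcongr
        exact hK _
    _ ≤ (∑' n, ‖coeff n g‖) * K := by
        rw [← Finset.sum_mul]
        gcongr
        exact hg.sum_le_tsum _ fun _ _ => norm_nonneg _

theorem C_mul (hf : HasBoundedCoeffs f) (c : 𝕜) : HasBoundedCoeffs (PowerSeries.C c * f) :=
  of_isBigO_one <| by simpa using hf.isBigO_one.const_mul_left c

theorem one_sub_X_mul (hf : HasBoundedCoeffs f) : HasBoundedCoeffs ((1 - X) * f) := by
  refine mul_left (summable_of_ne_finset_zero (s := Finset.range 2) fun n hn => ?_) hf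
  have hn : 1 < n := by simpa using hn
  rw [map_sub, coeff_one, coeff_X, if_neg (by lia), if_neg (by lia), sub_zero, norm_zero]

end HasBoundedCoeffs

theorem summable_coeff_halfBinomSeries {β : ℝ} (h0 : 0 < β) (h1 : β < 1) :
    Summable fun n => ‖coeff n (halfBinomSeries β)‖ := by
  refine ((summable_abs_negBinomCoeff h0 h1).mul_left (2 ^ (-β))).congr fun n => ?_
  rw [halfBinomSeries, coeff_mk, genBinom_eq_negBinomCoeff, norm_mul, norm_mul, norm_pow]
  simp [abs_of_pos (Real.rpow_pos_of_pos (two_pos (α := ℝ)) _)]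

theorem one_sub_X_mul_negBinomSeries (s : ℝ) :
    (1 - X) * negBinomSeries s = negBinomSeries (s - 1) := by
  rw [← negBinomSeries_neg_one, ← negBinomSeries_add, neg_add_eq_sub]

theorem isBigO_rpow_negBinomCoeff {s : ℝ} (hs : 0 < s) :
    (fun n : ℕ => (n : ℝ) ^ (s - 1)) =O[atTop] negBinomCoeff s := by
  have hG := Real.Gamma_pos_of_pos (by linarith : 0 < s + 1)
  refine IsBigO.of_bound (2 * (s + 1) * Real.Gamma (s + 1) / s) ?_
  filter_upwards [(tendsto_Gamma_mul_negBinomCoeff hs).eventually_const_le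
    (by norm_num : (1 / 2 : ℝ) < 1), eventually_gt_atTop 0] with n hn hn0
  have hn1 : (1 : ℝ) ≤ n := by exact_mod_cast hn0
  have hpos := negBinomCoeff_pos hs n
  have hpow : 0 < (n : ℝ) ^ s := Real.rpow_pos_of_pos (by linarith) _
  rw [le_div_iff₀ hpow] at hn
  rw [Real.norm_of_nonneg (by positivity), Real.norm_of_nonneg hpos.le,
    Real.rpow_sub_one (by linarith), div_mul_eq_mul_div, div_le_div_iff₀ (by linarith) hs]
  have h := add_natCast_mul_negBinomCoeff s n
  calc (n : ℝ) ^ s * s ≤ 2 * (Real.Gamma (s + 1) * negBinomCoeff (s + 1) n) * s := by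
        gcongr
        linarith
    _ = 2 * Real.Gamma (s + 1) * negBinomCoeff s n * (s + n) := by
        linear_combination (-2 * Real.Gamma (s + 1)) * h
    _ ≤ 2 * Real.Gamma (s + 1) * negBinomCoeff s n * ((s + 1) * n) := by
        gcongr
        nlinarith
    _ = 2 * (s + 1) * Real.Gamma (s + 1) * negBinomCoeff s n * n := by ring

/-- The normalized monomials `n ^ σ / Γ(σ + 1)`, as a power series. -/
noncomputable def monomialSeries (σ : ℝ) : ℝ⟦X⟧ :=
  mk fun n => (n : ℝ) ^ σ / Real.Gamma (σ + 1)

theorem isBigO_coeff_monomialSeries_sub {σ : ℝ} (hσ : 0 ≤ σ) :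
    (fun n => coeff n (monomialSeries σ - (negBinomSeries (σ + 1) -
      PowerSeries.C ((σ + 1) / 2) * negBinomSeries σ))) =O[atTop]
      fun n : ℕ => (n : ℝ) ^ (σ - 2) := by
  have hG := Real.Gamma_pos_of_pos (by linarith : 0 < σ + 1)
  refine ((isBigO_rpow_sub_negBinomCoeff hσ).const_mul_left (Real.Gamma (σ + 1))⁻¹).congr_left
    fun n => ?_
  simp only [monomialSeries, map_sub, coeff_mk, coeff_C_mul, coeff_negBinomSeries]
  field_simp

theorem isBigO_natCast_rpow_of_le {s t : ℝ} (h : s ≤ t) :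
    (fun n : ℕ => (n : ℝ) ^ s) =O[atTop] fun n : ℕ => (n : ℝ) ^ t := by
  refine IsBigO.of_bound 1 ?_
  filter_upwards [eventually_gt_atTop 0] with n hn
  rw [one_mul, Real.norm_of_nonneg (by positivity), Real.norm_of_nonneg (by positivity)]
  exact Real.rpow_le_rpow_of_exponent_le (by exact_mod_cast hn) h

theorem hasBoundedCoeffs_negBinomSeries_mul {β : ℝ} (h0 : 0 < β) (h1 : β < 1) {f : ℝ⟦X⟧}
    (hf : (fun n => coeff n f) =O[atTop] fun n : ℕ => (n : ℝ) ^ (-β)) :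
    HasBoundedCoeffs (negBinomSeries β * f) := by
  have h := isBigO_rpow_negBinomCoeff (by linarith : 0 < 1 - β)
  rw [sub_sub_cancel_left] at h
  obtain ⟨K, hK, hb⟩ := bound_of_isBigO_nat_atTop (hf.trans h)
  refine ⟨K, fun n => ?_⟩
  have hpos := fun k => negBinomCoeff_pos (by linarith : 0 < 1 - β) k
  have hsum : coeff n (negBinomSeries β * negBinomSeries (1 - β)) = 1 := by
    rw [← negBinomSeries_add, add_sub_cancel, coeff_negBinomSeries, negBinomCoeff_one]
  rw [coeff_mul] at hsum ⊢
  rw [← mul_one K, ← hsum, Finset.mul_sum]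
  refine norm_sum_le_of_le _ fun p _ => ?_
  have := hb (hpos p.2).ne'
  rw [Real.norm_of_nonneg (hpos p.2).le] at this
  rw [coeff_negBinomSeries, coeff_negBinomSeries, norm_mul,
    Real.norm_of_nonneg (negBinomCoeff_pos h0 _).le, mul_left_comm]
  exact mul_le_mul_of_nonneg_left this (negBinomCoeff_pos h0 _).le

theorem hasBoundedCoeffs_monomialSeries_sub {β σ : ℝ} (h0 : 0 < β) (h1 : β < 1) (hσ0 : 0 ≤ σ)
    (hσ : σ ≤ 2 - β) :
    HasBoundedCoeffs (monomialSeries (σ + β) - mk (omegaCoef β) * monomialSeries σ) := by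
  set f := monomialSeries σ - (negBinomSeries (σ + 1) -
    PowerSeries.C ((σ + 1) / 2) * negBinomSeries σ) with hf
  set g := monomialSeries (σ + β) - (negBinomSeries (σ + β + 1) -
    PowerSeries.C ((σ + β + 1) / 2) * negBinomSeries (σ + β)) with hg
  have hgb : HasBoundedCoeffs g := by
    refine .of_isBigO_one ((isBigO_coeff_monomialSeries_sub (by linarith)).trans ?_)
    simpa using isBigO_natCast_rpow_of_le (by linarith : σ + β - 2 ≤ 0)
  have hfb : HasBoundedCoeffs (negBinomSeries β * f) :=
    hasBoundedCoeffs_negBinomSeries_mul h0 h1 <|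
      (isBigO_coeff_monomialSeries_sub hσ0).trans (isBigO_natCast_rpow_of_le (by linarith))
  have hT : HasBoundedCoeffs (negBinomSeries (σ + β - 1)) :=
    ⟨1, fun n => by
      rw [coeff_negBinomSeries]
      exact abs_negBinomCoeff_le_one (by linarith) (by linarith) n⟩
  have e1 : (1 - X) * negBinomSeries (σ + β + 1) = negBinomSeries (σ + β) := by
    rw [one_sub_X_mul_negBinomSeries, add_sub_cancel_right]
  have e2 := one_sub_X_mul_negBinomSeries (σ + β)
  have e3 : negBinomSeries β * negBinomSeries (σ + 1) = negBinomSeries (σ + β + 1) := by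
    rw [← negBinomSeries_add]
    congr 1
    ring
  have e4 : negBinomSeries β * negBinomSeries σ = negBinomSeries (σ + β) := by
    rw [← negBinomSeries_add, add_comm]
  have e5 : (PowerSeries.C ((σ + β + 1) / 2) : ℝ⟦X⟧) =
      PowerSeries.C ((σ + 1) / 2) + PowerSeries.C (β / 2) := by
    rw [← map_add]
    congr 1
    ring
  have key : monomialSeries (σ + β) - mk (omegaCoef β) * monomialSeries σ =
      g - PowerSeries.C (β / 2) * (PowerSeries.C ((σ + 1) / 2) * negBinomSeries (σ + β - 1)) -
      remainderSeries β * (negBinomSeries (σ + β - 1) -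
        PowerSeries.C ((σ + 1) / 2) * ((1 - X) * negBinomSeries (σ + β - 1))) -
      halfBinomSeries β * (negBinomSeries β * f) := by
    rw [mk_omegaCoef h0, mul_assoc, hg, hf, mul_sub (negBinomSeries β), mul_sub (negBinomSeries β),
      e3, mul_left_comm (negBinomSeries β), e4, ← e2, ← e1, e5, halfBinomSeries_eq h0 h1]
    ring
  rw [key]
  exact ((hgb.sub ((hT.C_mul _).C_mul _)).sub (.mul_left (summable_coeff_remainderSeries h0 h1)
    (hT.sub (hT.one_sub_X_mul.C_mul _)))).sub
    (hfb.mul_left (summable_coeff_halfBinomSeries h0 h1))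

theorem isBigO_quadrature_error {β σ : ℝ} (h0 : 0 < β) (h1 : β < 1) (hσ0 : 0 ≤ σ)
    (hσ : σ ≤ 2 - β) :
    (fun n : ℕ => Real.Gamma (σ + 1) / Real.Gamma (σ + 1 + β) * (n : ℝ) ^ (σ + β) -
      ∑ j ∈ Finset.range (n + 1), omegaCoef β (n - j) * (j : ℝ) ^ σ) =O[atTop]
      fun _ => (1 : ℝ) := by
  have hG := (Real.Gamma_pos_of_pos (by linarith : 0 < σ + 1)).ne'
  refine ((hasBoundedCoeffs_monomialSeries_sub h0 h1 hσ0 hσ).isBigO_one.const_mul_left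
    (Real.Gamma (σ + 1))).congr_left fun n => ?_
  rw [map_sub, mul_comm (PowerSeries.mk _), coeff_mul,
    Finset.Nat.sum_antidiagonal_eq_sum_range_succ_mk, mul_sub, Finset.mul_sum]
  simp only [monomialSeries, coeff_mk]
  rw [show σ + 1 + β = σ + β + 1 by ring]
  congr 1
  · ring
  · refine Finset.sum_congr rfl fun j _ => ?_
    field_simp

theorem isBigO_startWeights {β : ℝ} (h0 : 0 < β) (h1 : β < 1) {m : ℕ} {σ : ℕ → ℝ}
    (hmono : StrictMonoOn σ (Set.Icc 1 m))
    (hσ : ∀ r ∈ Finset.Icc 1 m, 0 < σ r ∧ σ r ≤ 2 - β)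
    {W : ℕ → ℕ → ℝ} (hW : ∀ n : ℕ, IsStartWeights β σ m n (W n)) :
    ∀ j ∈ Finset.Icc 1 m, (fun n => W n j) =O[atTop] fun _ => (1 : ℝ) :=
  isBigO_one_of_vandermonde m σ hmono W fun r hr =>
    (isBigO_quadrature_error h0 h1 (hσ r hr).1.le (hσ r hr).2).congr_left
      fun n => (hW n r hr).symm

theorem isBigO_Bweight {β : ℝ} (h0 : 0 < β) (h1 : β < 1) {m : ℕ} {W : ℕ → ℕ → ℝ}
    (hW : ∀ j ∈ Finset.Icc 1 m, (fun n => W n j) =O[atTop] fun _ => (1 : ℝ)) :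
    (fun n => Bweight β (omegaCoef β) (W n) m n) =O[atTop] fun _ => (1 : ℝ) := by
  refine ((isBigO_quadrature_error h0 h1 le_rfl (by linarith)).sub
    (IsBigO.sum hW)).congr_left fun n => ?_
  simp [Bweight, div_eq_inv_mul]

/-- Evaluation of the complexification of a real power series. -/
noncomputable def evalC (f : ℝ⟦X⟧) (w : ℂ) : ℂ :=
  ∑' n, ((coeff n f : ℝ) : ℂ) * w ^ n

theorem summable_norm_coeff_mul_pow {f : ℝ⟦X⟧} (hf : Summable fun n => ‖coeff n f‖) {w : ℂ}
    (hw : ‖w‖ ≤ 1) : Summable fun n => ‖((coeff n f : ℝ) : ℂ) * w ^ n‖ := by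
  refine hf.of_nonneg_of_le (fun _ => norm_nonneg _) fun n => ?_
  rw [norm_mul, Complex.norm_real, norm_pow]
  exact mul_le_of_le_one_right (norm_nonneg _) (pow_le_one₀ (norm_nonneg _) hw)

theorem HasBoundedCoeffs.summable_norm_coeff_mul_pow {f : ℝ⟦X⟧} (hf : HasBoundedCoeffs f) {w : ℂ}
    (hw : ‖w‖ < 1) : Summable fun n => ‖((coeff n f : ℝ) : ℂ) * w ^ n‖ := by
  obtain ⟨K, hK⟩ := hf
  refine ((summable_geometric_of_lt_one (norm_nonneg _) hw).mul_left K).of_nonneg_of_le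
    (fun _ => norm_nonneg _) fun n => ?_
  rw [norm_mul, Complex.norm_real, norm_pow]
  exact mul_le_mul_of_nonneg_right (hK n) (by positivity)

theorem evalC_mul {f g : ℝ⟦X⟧} {w : ℂ} (hf : Summable fun n => ‖((coeff n f : ℝ) : ℂ) * w ^ n‖)
    (hg : Summable fun n => ‖((coeff n g : ℝ) : ℂ) * w ^ n‖) :
    evalC (f * g) w = evalC f w * evalC g w := by
  rw [evalC, evalC, evalC, tsum_mul_tsum_eq_tsum_sum_antidiagonal_of_summable_norm hf hg]
  refine tsum_congr fun n => ?_
  rw [coeff_mul, Complex.ofReal_sum, Finset.sum_mul]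
  refine Finset.sum_congr rfl fun p hp => ?_
  rw [← Finset.HasAntidiagonal.mem_antidiagonal.1 hp, pow_add, Complex.ofReal_mul]
  ring

theorem continuousOn_evalC {f : ℝ⟦X⟧} (hf : Summable fun n => ‖coeff n f‖) :
    ContinuousOn (evalC f) (Metric.closedBall 0 1) := by
  refine continuousOn_tsum (fun n => by fun_prop) hf fun n w hw => ?_
  rw [norm_mul, Complex.norm_real, norm_pow]
  exact mul_le_of_le_one_right (norm_nonneg _)
    (pow_le_one₀ (norm_nonneg _) (mem_closedBall_zero_iff.1 hw))

theorem summable_coeff_negBinomSeries {β : ℝ} (h0 : 0 < β) (h1 : β < 1) :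
    Summable fun n => ‖coeff n (negBinomSeries (-β))‖ := by
  simpa [coeff_negBinomSeries] using summable_abs_negBinomCoeff h0 h1

theorem hasBoundedCoeffs_mk_omegaCoef {β : ℝ} (h0 : 0 < β) (h1 : β < 1) :
    HasBoundedCoeffs (mk (omegaCoef β)) := by
  rw [mk_omegaCoef h0]
  refine .mul_left (summable_coeff_halfBinomSeries h0 h1) ⟨1, fun n => ?_⟩
  rw [coeff_negBinomSeries]
  exact abs_negBinomCoeff_le_one (by linarith) h1.le n

theorem negBinomSeries_neg_mul_mk_omegaCoef {β : ℝ} (h0 : 0 < β) :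
    negBinomSeries (-β) * mk (omegaCoef β) = halfBinomSeries β := by
  rw [mk_omegaCoef h0, mul_left_comm, ← negBinomSeries_add, neg_add_cancel, negBinomSeries_zero,
    mul_one]

theorem eq_one_of_evalC_negBinomSeries_eq_zero {β : ℝ} (h0 : 0 < β) (h1 : β < 1) {w : ℂ}
    (hw : ‖w‖ ≤ 1) (h : evalC (negBinomSeries (-β)) w = 0) : w = 1 := by
  have hs : HasSum (fun n => (negBinomCoeff (-β) n : ℂ) * w ^ n) 0 := by
    have := (summable_norm_coeff_mul_pow (summable_coeff_negBinomSeries h0 h1) hw).of_norm.hasSum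
    rw [← evalC, h] at this
    simpa only [coeff_negBinomSeries] using this
  have hs1 : HasSum (fun n => negBinomCoeff (-β) (n + 1) * (w ^ (n + 1)).re) (-1) := by
    have := Complex.hasSum_re ((hasSum_nat_add_iff' 1).2 hs)
    simpa using this
  have habs (n : ℕ) : |negBinomCoeff (-β) (n + 1)| = -negBinomCoeff (-β) (n + 1) :=
    abs_of_neg (negBinomCoeff_neg_of_neg h0 h1 n)
  have hs2 := hs1.add (summable_abs_negBinomCoeff_succ h0 h1).hasSum
  have hre (n : ℕ) : (w ^ (n + 1)).re ≤ 1 :=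
    (Complex.re_le_norm _).trans (by rw [norm_pow]; exact pow_le_one₀ (norm_nonneg _) hw)
  have hle := le_hasSum hs2 0 fun n _ => by
    rw [habs]
    nlinarith [negBinomCoeff_neg_of_neg h0 h1 n, hre n]
  have htot := tsum_abs_negBinomCoeff_succ_le h0 h1
  have hneg := negBinomCoeff_neg_of_neg h0 h1 0
  rw [habs, zero_add, pow_one] at hle
  rw [zero_add] at hneg
  have hre1 : 1 ≤ w.re := by nlinarith
  have hsq : w.re ^ 2 + w.im ^ 2 ≤ 1 := by
    have := Complex.sq_norm_sub_sq_re w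
    nlinarith [norm_nonneg w]
  exact Complex.ext (by rw [Complex.one_re]; nlinarith [sq_nonneg w.im])
    (by rw [Complex.one_im]; nlinarith [sq_nonneg w.im])

theorem evalC_halfBinomSeries (β : ℝ) (w : ℂ) :
    evalC (halfBinomSeries β) w =
      ((2 ^ (-β) : ℝ) : ℂ) * evalC (negBinomSeries (-β)) (-w) := by
  rw [evalC, evalC, ← tsum_mul_left]
  refine tsum_congr fun n => ?_
  rw [halfBinomSeries, coeff_mk, coeff_negBinomSeries, genBinom_eq_negBinomCoeff, neg_pow w]
  push_cast
  ring

theorem evalC_sub_mul_evalC_ne_zero {β : ℝ} (h0 : 0 < β) (h1 : β < 1) {ξ : ℂ} (hξ : ξ ≠ 0) {c : ℝ}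
    (hc : 0 < c) (hinf : ∀ z : ℂ, ‖z‖ < 1 → c ≤ ‖1 - ξ * omegaFnC β z‖) {w : ℂ} (hw : ‖w‖ ≤ 1) :
    evalC (negBinomSeries (-β)) w - ξ * evalC (halfBinomSeries β) w ≠ 0 := by
  have hP := summable_coeff_negBinomSeries h0 h1
  have hY := summable_coeff_halfBinomSeries h0 h1
  have hball (z : ℂ) (hz : z ∈ Metric.ball (0 : ℂ) 1) :
      c * ‖evalC (negBinomSeries (-β)) z‖ ≤
        ‖evalC (negBinomSeries (-β)) z - ξ * evalC (halfBinomSeries β) z‖ := by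
    rw [mem_ball_zero_iff] at hz
    have hω : evalC (mk (omegaCoef β)) z = omegaFnC β z := by simp [evalC, omegaFnC]
    rw [← negBinomSeries_neg_mul_mk_omegaCoef h0, evalC_mul
      (summable_norm_coeff_mul_pow hP hz.le)
      ((hasBoundedCoeffs_mk_omegaCoef h0 h1).summable_norm_coeff_mul_pow hz), hω, mul_comm c,
      mul_left_comm, ← mul_one_sub, norm_mul]
    exact mul_le_mul_of_nonneg_left (hinf z hz) (norm_nonneg _)
  have hcl : closure (Metric.ball (0 : ℂ) 1) = Metric.closedBall 0 1 :=
    closure_ball _ one_ne_zero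
  have hle := le_on_closure hball
    (by rw [hcl]; exact continuousOn_const.mul (continuousOn_evalC hP).norm)
    (by rw [hcl]; exact ((continuousOn_evalC hP).sub
      (continuousOn_const.mul (continuousOn_evalC hY))).norm)
    (show w ∈ closure (Metric.ball (0 : ℂ) 1) by rwa [hcl, mem_closedBall_zero_iff])
  intro h
  rw [h, norm_zero] at hle
  have hPw : evalC (negBinomSeries (-β)) w = 0 := by
    rw [← norm_le_zero_iff]
    exact nonpos_of_mul_nonpos_right hle hc
  have hw1 := eq_one_of_evalC_negBinomSeries_eq_zero h0 h1 hw hPw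
  rw [hPw, zero_sub, neg_eq_zero, evalC_halfBinomSeries, mul_eq_zero, mul_eq_zero,
    Complex.ofReal_eq_zero] at h
  have hPn := (h.resolve_left hξ).resolve_left (Real.rpow_pos_of_pos two_pos _).ne'
  have hw2 := eq_one_of_evalC_negBinomSeries_eq_zero h0 h1 (by rwa [norm_neg]) hPn
  rw [hw1] at hw2
  norm_num at hw2

theorem hasBoundedCoeffs_of_one_sub_mul {β : ℝ} (h0 : 0 < β) (h1 : β < 1) {ξ : ℂ} (hξ : ξ ≠ 0)
    {c : ℝ} (hc : 0 < c) (hinf : ∀ z : ℂ, ‖z‖ < 1 → c ≤ ‖1 - ξ * omegaFnC β z‖) {f : ℂ⟦X⟧}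
    (hf : HasBoundedCoeffs
      (f - PowerSeries.C ξ * (PowerSeries.map Complex.ofRealHom (mk (omegaCoef β)) * f))) :
    HasBoundedCoeffs f := by
  have hP := summable_coeff_negBinomSeries h0 h1
  have hY := summable_coeff_halfBinomSeries h0 h1
  have hcoeff (n : ℕ) : coeff n (PowerSeries.map Complex.ofRealHom (negBinomSeries (-β)) -
      PowerSeries.C ξ * PowerSeries.map Complex.ofRealHom (halfBinomSeries β)) =
      ((coeff n (negBinomSeries (-β)) : ℝ) : ℂ) - ξ * ((coeff n (halfBinomSeries β) : ℝ) : ℂ) := by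
    simp
  obtain ⟨K, hK⟩ := HasBoundedCoeffs.mul_left
    (g := PowerSeries.map Complex.ofRealHom (negBinomSeries (-β))) (by simpa using hP) hf
  refine bounded_of_mul_bounded (PowerSeries.map Complex.ofRealHom (negBinomSeries (-β)) -
    PowerSeries.C ξ * PowerSeries.map Complex.ofRealHom (halfBinomSeries β)) f ?_ ?_ K ?_
  · refine (hP.add (hY.mul_left ‖ξ‖)).of_nonneg_of_le (fun _ => norm_nonneg _) fun n => ?_
    rw [hcoeff]
    refine (norm_sub_le _ _).trans_eq ?_
    rw [norm_mul, Complex.norm_real, Complex.norm_real]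
  · intro w hw
    have h := evalC_sub_mul_evalC_ne_zero h0 h1 hξ hc hinf hw
    rw [evalC, evalC, ← tsum_mul_left, ← (summable_norm_coeff_mul_pow hP hw).of_norm.tsum_sub
      ((summable_norm_coeff_mul_pow hY hw).of_norm.mul_left ξ)] at h
    simpa only [hcoeff, sub_mul, mul_assoc] using h
  · suffices h : (PowerSeries.map Complex.ofRealHom (negBinomSeries (-β)) -
        PowerSeries.C ξ * PowerSeries.map Complex.ofRealHom (halfBinomSeries β)) * f =
        PowerSeries.map Complex.ofRealHom (negBinomSeries (-β)) *
          (f - PowerSeries.C ξ *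
            (PowerSeries.map Complex.ofRealHom (mk (omegaCoef β)) * f)) from
      fun n => h ▸ hK n
    rw [← negBinomSeries_neg_mul_mk_omegaCoef h0, map_mul]
    ring

/-- Theorem 3.4: linear stability of the IMEX-T scheme for the test equation
`^CD_0^β u = λu + ρu` (with `f(t,u) = (λ+ρ)u`, for which the Taylor
linearization is exact).  If `ξ = (λ+ρ)h^β` and `1 − ξω^{(β)}(z)` stays away
from zero on the unit disk, the numerical solution is bounded for every choice
of starting values. -/
theorem imexT_linear_stability (β : ℝ) (hβ0 : 0 < β) (hβ1 : β < 1)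
    (lam ρ : ℂ) (h : ℝ) (hh : 0 < h) (m : ℕ) (σ : ℕ → ℝ)
    (hmono : StrictMonoOn σ (Set.Icc 1 m))
    (hσ : ∀ r ∈ Finset.Icc 1 m, 0 < σ r ∧ σ r ≤ 2 - β)
    (Wσ : ℕ → ℕ → ℝ) (hWσ : ∀ n : ℕ, IsStartWeights β σ m n (Wσ n))
    (c : ℝ) (hc : 0 < c)
    (hinf : ∀ z : ℂ, ‖z‖ < 1 →
      c ≤ ‖1 - (lam + ρ) * ((h ^ β : ℝ) : ℂ) * omegaFnC β z‖)
    (U : ℕ → ℂ)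
    (hU : ∀ n : ℕ, max 2 (m + 1) ≤ n →
      U n = U 0 + (lam + ρ) * ((h ^ β : ℝ) : ℂ) *
        ((∑ j ∈ Finset.range (n + 1), (omegaCoef β (n - j) : ℂ) * U j) +
          (∑ j ∈ Finset.Icc 1 m, (Wσ n j : ℂ) * U j) +
          (Bweight β (omegaCoef β) (Wσ n) m n : ℂ) * U 0)) :
    ∃ M : ℝ, ∀ n : ℕ, ‖U n‖ ≤ M := by
  set ξ := (lam + ρ) * ((h ^ β : ℝ) : ℂ)
  have hW := isBigO_startWeights hβ0 hβ1 hmono hσ hWσ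
  have hB := isBigO_Bweight hβ0 hβ1 hW
  have hbdd : (fun n => U 0 + ξ * ((∑ j ∈ Finset.Icc 1 m, (Wσ n j : ℂ) * U j) +
      (Bweight β (omegaCoef β) (Wσ n) m n : ℂ) * U 0)) =O[atTop] fun _ => (1 : ℝ) := by
    refine (isBigO_const_const _ one_ne_zero _).add 
      (((IsBigO.fun_sum fun j hj => ?_).add ?_).const_mul_left _)
    · simpa using (Complex.isBigO_ofReal_left.2 (hW j hj)).mul
        (isBigO_const_const (U j) (one_ne_zero (α := ℝ)) atTop)
    · simpa using (Complex.isBigO_ofReal_left.2 hB).mul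
        (isBigO_const_const (U 0) (one_ne_zero (α := ℝ)) atTop)
  have hG : HasBoundedCoeffs (mk U -
      PowerSeries.C ξ * (PowerSeries.map Complex.ofRealHom (mk (omegaCoef β)) * mk U)) := by
    refine .of_isBigO_one (hbdd.congr' ?_ EventuallyEq.rfl)
    filter_upwards [eventually_ge_atTop (max 2 (m + 1))] with n hn
    rw [map_sub, coeff_C_mul, mul_comm (PowerSeries.map _ _), coeff_mul,
      Finset.Nat.sum_antidiagonal_eq_sum_range_succ_mk]
    simp only [coeff_mk, coeff_map, Complex.ofRealHom_eq_coe, mul_comm (U _) (omegaCoef β _ : ℂ)]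
    linear_combination -hU n hn
  have hUb : HasBoundedCoeffs (mk U) := by
    rcases eq_or_ne ξ 0 with hξ | hξ
    · simpa [hξ] using hG
    · exact hasBoundedCoeffs_of_one_sub_mul hβ0 hβ1 hξ hc hinf hG
  simpa [HasBoundedCoeffs] using hUb
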